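/- Every caterpillar tree T = Cat(d₁, …, d₇) of length 7 with σ(T) = 7 and σ(T) ≥ Δ(T) + 2 is 7-two-sided strong edge-pre-colorable. -/

import Mathlib

open SimpleGraph

/-- The degree of a vertex (cardinality of its neighbor set). -/
noncomputable def ndeg {V : Type*} (G : SimpleGraph V) (v : V) : ℕ :=
  (G.neighborSet v).ncard

/-- `σ(G)`: the maximum of `deg x + deg y - 1` over all edges `xy` of `G`. -/
noncomputable def sigmaG {V : Type*} (G : SimpleGraph V) : ℕ :=
  sSup {m | ∃ x y, G.Adj x y ∧ m = ndeg G x + ndeg G y - 1}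

/-- The maximum degree `Δ(G)`. -/
noncomputable def maxDeg {V : Type*} (G : SimpleGraph V) : ℕ :=
  sSup (Set.range (ndeg G))

/-- Two edges are at distance at most two: they share an endpoint, or an endpoint of
one is adjacent to an endpoint of the other. -/
def EdgesNear {V : Type*} (G : SimpleGraph V) (e f : Sym2 V) : Prop :=
  ∃ u v, u ∈ e ∧ v ∈ f ∧ (u = v ∨ G.Adj u v)

/-- A strong edge-coloring: every two distinct edges at distance at most two
receive different colors. -/
def IsStrongEdgeColoring {V α : Type*} (G : SimpleGraph V) (φ : Sym2 V → α) : Prop :=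
  ∀ e ∈ G.edgeSet, ∀ f ∈ G.edgeSet, e ≠ f → EdgesNear G e f → φ e ≠ φ f

/-- The strong chromatic index `χ'ₛ(G)`: the least `k` such that `G` has a strong
edge-coloring with colors `0, …, k-1`. -/
noncomputable def strongChromaticIndex {V : Type*} (G : SimpleGraph V) : ℕ :=
  sInf {k | ∃ φ : Sym2 V → ℕ, (∀ e ∈ G.edgeSet, φ e < k) ∧ IsStrongEdgeColoring G φ}

/-- The set of edges incident with a vertex `v`. -/
def Einc {V : Type*} (G : SimpleGraph V) (v : V) : Set (Sym2 V) :=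
  {e ∈ G.edgeSet | v ∈ e}
/-- The vertex type of the caterpillar tree `Cat(d 1, …, d ℓ)`: the spine
`x_0, x_1, …, x_{ℓ+1}` (as `Fin (ℓ+2)`) together with `d (i+1) - 2` pendant leaves
attached to the spine vertex `x_{i+1}` for each `i : Fin ℓ`. -/
abbrev CatV (ℓ : ℕ) (d : ℕ → ℕ) : Type :=
  Fin (ℓ + 2) ⊕ (Σ i : Fin ℓ, Fin (d (i.val + 1) - 2))

/-- Generating relation for the caterpillar: consecutive spine vertices are adjacent,
and each leaf in the `i`-th leaf group is adjacent to the spine vertex `x_{i+1}`. -/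
def CatRel (ℓ : ℕ) (d : ℕ → ℕ) : CatV ℓ d → CatV ℓ d → Prop
  | Sum.inl i, Sum.inl j => (j : ℕ) = (i : ℕ) + 1
  | Sum.inr p, Sum.inl k => (k : ℕ) = (p.1 : ℕ) + 1
  | _, _ => False

/-- The caterpillar tree `Cat(d 1, …, d ℓ)` with spine `x_0, …, x_{ℓ+1}`, in which
the spine vertex `x_i` has degree `d i` for `1 ≤ i ≤ ℓ` (provided `d i ≥ 2`). -/
def Cat (ℓ : ℕ) (d : ℕ → ℕ) : SimpleGraph (CatV ℓ d) :=
  SimpleGraph.fromRel (CatRel ℓ d)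

/-- There exists a strong edge-coloring `φ` of `Cat ℓ d` using colors from `C` with
`φ(E 1) = C₁`, `φ(E ℓ) = Cl`, `φ(x₀x₁) = α₀` and `φ(x_ℓ x_{ℓ+1}) = αl`. -/
def CatPrecolorExists (ℓ : ℕ) (d : ℕ → ℕ) (C C₁ Cl : Finset ℕ) (α₀ αl : ℕ) : Prop :=
  ∃ φ : Sym2 (CatV ℓ d) → ℕ,
    (∀ e ∈ (Cat ℓ d).edgeSet, φ e ∈ C) ∧
    IsStrongEdgeColoring (Cat ℓ d) φ ∧
    φ '' Einc (Cat ℓ d) (Sum.inl ⟨1, by omega⟩) = ↑C₁ ∧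
    φ '' Einc (Cat ℓ d) (Sum.inl ⟨ℓ, by omega⟩) = ↑Cl ∧
    φ s(Sum.inl ⟨0, by omega⟩, Sum.inl ⟨1, by omega⟩) = α₀ ∧
    φ s(Sum.inl ⟨ℓ, by omega⟩, Sum.inl ⟨ℓ + 1, by omega⟩) = αl

/-- `Cat ℓ d` is `κ`-two-sided strong edge-pre-colorable: for every `κ`-set `C` of colors,
all `C₁, Cl ⊆ C` with `|C₁| = d 1`, `|Cl| = d ℓ`, and all `α₀ ∈ C₁`, `αl ∈ Cl`, there is
a strong edge-coloring `φ` of `Cat ℓ d` with colors from `C` such that `φ(E 1) = C₁`,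
`φ(E ℓ) = Cl`, `φ(x₀x₁) = α₀` and `φ(x_ℓ x_{ℓ+1}) = αl`. -/
def TwoSidedPrecolorable (ℓ : ℕ) (d : ℕ → ℕ) (κ : ℕ) : Prop :=
  ∀ C C₁ Cl : Finset ℕ, C.card = κ → C₁ ⊆ C → Cl ⊆ C →
    C₁.card = d 1 → Cl.card = d ℓ →
    ∀ α₀ ∈ C₁, ∀ αl ∈ Cl, CatPrecolorExists ℓ d C C₁ Cl α₀ αl

/-- `ℓ_σ` from the refined key lemma: `ℓ_5 = 8`, `ℓ_6 = ℓ_7 = 7`, `ℓ_σ = σ` for `σ ≥ 8`. -/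
def ellSigma (s : ℕ) : ℕ :=
  if s = 5 then 8 else if s ≤ 7 then 7 else s


/-! ### The finite computation: reachable types -/

/-- A type `(a, b, e, r)`: numbers of colors in the three classes, and the class of the
outgoing spine color. -/
abbrev CTy := ℕ × ℕ × ℕ × ℕ

def tyGet (t : CTy) (j : ℕ) : ℕ :=
  bif Nat.beq j 0 then t.1 else bif Nat.beq j 1 then t.2.1 else t.2.2.1

def tyDel (j r : ℕ) : ℕ := bif Nat.beq j r then 1 else 0

def tyTypes (N1 N2 d : ℕ) : List CTy :=
  ((List.range 2).flatMap fun a => (List.range (d + 1)).flatMap fun b =>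
    (List.range 3).map fun r => ((a, b, d - a - b, r) : CTy)).filter fun t =>
      Nat.beq (t.1 + t.2.1 + t.2.2.1) d && Nat.ble t.2.1 N1 && Nat.ble t.2.2.1 N2 &&
        Nat.ble 1 (tyGet t t.2.2.2)

def tyTrans (N1 N2 : ℕ) (t u : CTy) : Bool :=
  Nat.ble (1 + tyDel t.2.2.2 u.2.2.2) (tyGet u t.2.2.2) &&
  (Nat.ble (t.1 + u.1) (1 + tyDel 0 t.2.2.2) &&
  (Nat.ble (t.2.1 + u.2.1) (N1 + tyDel 1 t.2.2.2) &&
  Nat.ble (t.2.2.1 + u.2.2.1) (N2 + tyDel 2 t.2.2.2)))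

def tyNext (N1 N2 : ℕ) (R : List CTy) (d : ℕ) : List CTy :=
  (tyTypes N1 N2 d).filter fun u => R.any fun t => tyTrans N1 N2 t u

def tyCheck (N1 N2 : ℕ) : ℕ → ℕ → List CTy → Bool
  | 0, dp, R => [2, 3, 4, 5].all fun d => !(Nat.ble (dp + d) 8) ||
      (tyTypes N1 N2 d).all fun u => R.any fun t => tyTrans N1 N2 t u
  | f + 1, dp, R => [3, 4, 5].all fun d => !(Nat.ble (dp + d) 8) ||
      tyCheck N1 N2 f d (tyNext N1 N2 R d)

set_option maxRecDepth 100000 in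
theorem tyCheck_ok :
    ([2, 3, 4, 5].all fun d => tyCheck (d - 1) (7 - d) 5 d [((1, d - 1, 0, 1) : CTy)]) = true := by
  decide +kernel

/-! ### Chains of color sets -/

structure CChain (d : ℕ → ℕ) (C C₁ : Finset ℕ) (α₀ : ℕ) (k : ℕ) (S : ℕ → Finset ℕ)
    (c : ℕ → ℕ) : Prop where
  c0 : c 0 = α₀
  s1 : S 1 = C₁
  sub : ∀ i, i < k → S (i + 1) ⊆ C
  crd : ∀ i, i < k → (S (i + 1)).card = d (i + 1)
  mem1 : ∀ i, i < k → c i ∈ S (i + 1)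
  mem2 : ∀ i, i < k → c (i + 1) ∈ S (i + 1)
  ne : ∀ i, i < k → c i ≠ c (i + 1)
  inter : ∀ i, 1 ≤ i → i < k → ∀ x ∈ S i, x ∈ S (i + 1) → x = c i

/-- The three color classes. -/
def cls (C C₁ : Finset ℕ) (α₀ : ℕ) (j : ℕ) : Finset ℕ :=
  if j = 0 then {α₀} else if j = 1 then C₁.erase α₀ else C \ C₁

structure HasTy (C C₁ : Finset ℕ) (α₀ : ℕ) (S : Finset ℕ) (c : ℕ) (t : CTy) : Prop where
  sub : S ⊆ C
  n : ∀ j, j < 3 → (S ∩ cls C C₁ α₀ j).card = tyGet t j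
  mem : c ∈ S
  memc : c ∈ cls C C₁ α₀ t.2.2.2

def RealTy (d : ℕ → ℕ) (C C₁ : Finset ℕ) (α₀ : ℕ) (k : ℕ) (t : CTy) : Prop :=
  ∀ S' c', HasTy C C₁ α₀ S' c' t →
    ∃ S c, CChain d C C₁ α₀ k S c ∧ S k = S' ∧ c k = c'

theorem cls_disj (C C₁ : Finset ℕ) (α₀ : ℕ) (h1 : C₁ ⊆ C) (h0 : α₀ ∈ C₁) (i j : ℕ)
    (hi : i < 3) (hj : j < 3) (x : ℕ) (hx : x ∈ cls C C₁ α₀ i) (hy : x ∈ cls C C₁ α₀ j) :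
    i = j := by
  interval_cases i <;> interval_cases j <;> simp [cls] at hx hy ⊢ <;> grind

theorem cls_sub (C C₁ : Finset ℕ) (α₀ : ℕ) (h1 : C₁ ⊆ C) (h0 : α₀ ∈ C₁) (j : ℕ) :
    cls C C₁ α₀ j ⊆ C := by
  intro x hx
  unfold cls at hx
  split_ifs at hx <;> simp at hx <;> grind

theorem cls_cover (C C₁ : Finset ℕ) (α₀ : ℕ) (x : ℕ) (hx : x ∈ C) :
    x ∈ cls C C₁ α₀ 0 ∨ x ∈ cls C C₁ α₀ 1 ∨ x ∈ cls C C₁ α₀ 2 := by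
  simp [cls]
  tauto

theorem cls_card (C C₁ : Finset ℕ) (α₀ : ℕ) (h1 : C₁ ⊆ C) (h0 : α₀ ∈ C₁) (S : Finset ℕ)
    (hS : S ⊆ C) :
    S.card = (S ∩ cls C C₁ α₀ 0).card + (S ∩ cls C C₁ α₀ 1).card
      + (S ∩ cls C C₁ α₀ 2).card := by
  have hd := cls_disj C C₁ α₀ h1 h0
  rw [← Finset.card_union_of_disjoint, ← Finset.card_union_of_disjoint]
  · congr 1
    ext x
    have := cls_cover C C₁ α₀ x
    simp only [Finset.mem_union, Finset.mem_inter]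
    constructor
    · intro hx
      have := this (hS hx)
      tauto
    · tauto
  · rw [Finset.disjoint_left]
    intro x hx hy
    simp only [Finset.mem_union, Finset.mem_inter] at hx hy
    rcases hx with hx | hx
    · have := hd 0 2 (by omega) (by omega) x hx.2 hy.2; omega
    · have := hd 1 2 (by omega) (by omega) x hx.2 hy.2; omega
  · rw [Finset.disjoint_left]
    intro x hx hy
    simp only [Finset.mem_inter] at hx hy
    have := hd 0 1 (by omega) (by omega) x hx.2 hy.2; omega

theorem tyDel_eq (j r : ℕ) : tyDel j r = if j = r then 1 else 0 := by
  unfold tyDel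
  by_cases h : j = r
  · subst h; simp
  · have : Nat.beq j r = false := by
      rw [← Bool.not_eq_true, Nat.beq_eq]; exact h
    simp [this, h]

theorem tyGet_zero (t : CTy) : tyGet t 0 = t.1 := rfl
theorem tyGet_one (t : CTy) : tyGet t 1 = t.2.1 := rfl
theorem tyGet_two (t : CTy) : tyGet t 2 = t.2.2.1 := rfl

theorem mem_tyTypes (N1 N2 d : ℕ) (t : CTy) : t ∈ tyTypes N1 N2 d ↔
    t.1 < 2 ∧ t.1 + t.2.1 + t.2.2.1 = d ∧ t.2.1 ≤ N1 ∧ t.2.2.1 ≤ N2 ∧ t.2.2.2 < 3 ∧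
      1 ≤ tyGet t t.2.2.2 := by
  obtain ⟨a, b, e, r⟩ := t
  simp only [tyTypes, List.mem_filter, List.mem_flatMap, List.mem_map, List.mem_range,
    Bool.and_eq_true, Nat.ble_eq, Nat.beq_eq, Prod.mk.injEq]
  constructor
  · rintro ⟨⟨a', ha', b', hb', r', hr', rfl, rfl, rfl, rfl⟩, h⟩
    tauto
  · rintro ⟨h1, h2, h3, h4, h5, h6⟩
    exact ⟨⟨a, h1, b, by omega, r, h5, rfl, rfl, by omega, rfl⟩, ⟨⟨h2, h3⟩, h4⟩, h6⟩

theorem real_step (d : ℕ → ℕ) (C C₁ : Finset ℕ) (α₀ : ℕ) (h1 : C₁ ⊆ C) (h0 : α₀ ∈ C₁)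
    (k : ℕ) (hk : 1 ≤ k) (N1 N2 : ℕ) (hN1 : (cls C C₁ α₀ 1).card = N1)
    (hN2 : (cls C C₁ α₀ 2).card = N2) (t u : CTy) (ht : t.2.2.2 < 3)
    (ht' : 1 ≤ tyGet t t.2.2.2)
    (hu : u ∈ tyTypes N1 N2 (d (k + 1))) (hR : RealTy d C C₁ α₀ k t)
    (htr : tyTrans N1 N2 t u = true) : RealTy d C C₁ α₀ (k + 1) u := by
  intro S' c' hS'
  have hdj := cls_disj C C₁ α₀ h1 h0
  rw [mem_tyTypes] at hu
  obtain ⟨hu1, hu2, hu3, hu4, hu5, hu6⟩ := hu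
  simp only [tyTrans, Bool.and_eq_true, Nat.ble_eq, tyDel_eq] at htr
  obtain ⟨htr0, htrs⟩ := htr
  set r := t.2.2.2 with hr
  have hN0 : (cls C C₁ α₀ 0).card = 1 := by simp [cls]
  have hall : ∀ j, j < 3 → tyGet t j + tyGet u j ≤
      (cls C C₁ α₀ j).card + if j = r then 1 else 0 := by
    intro j hj
    interval_cases j
    · rw [hN0]; exact htrs.1
    · rw [hN1]; exact htrs.2.1
    · rw [hN2]; exact htrs.2.2
  obtain ⟨c, hcS, hcr, hcc⟩ : ∃ c, c ∈ S' ∧ c ∈ cls C C₁ α₀ r ∧ c ≠ c' := by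
    have hcard := hS'.n r ht
    by_cases hrr : r = u.2.2.2
    · rw [if_pos hrr] at htr0
      have : 1 < (S' ∩ cls C C₁ α₀ r).card := by omega
      obtain ⟨c, hc, hne⟩ := Finset.exists_mem_ne this c'
      rw [Finset.mem_inter] at hc
      exact ⟨c, hc.1, hc.2, hne⟩
    · rw [if_neg hrr] at htr0
      have : 0 < (S' ∩ cls C C₁ α₀ r).card := by omega
      obtain ⟨c, hc⟩ := Finset.card_pos.1 this
      rw [Finset.mem_inter] at hc
      refine ⟨c, hc.1, hc.2, ?_⟩
      rintro rfl
      exact hrr (hdj _ _ ht hu5 c hc.2 hS'.memc)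
  have hU : ∀ j, ∃ U : Finset ℕ, j < 3 → U ⊆ cls C C₁ α₀ j ∧ U.card = tyGet t j ∧
      (j = r → c ∈ U) ∧ ∀ x ∈ U, x ∈ S' → x = c := by
    intro j
    by_cases hj : j < 3
    swap
    · exact ⟨∅, fun h => absurd h hj⟩
    have hA := hall j hj
    have hcd : (cls C C₁ α₀ j \ S').card + tyGet u j = (cls C C₁ α₀ j).card := by
      rw [← hS'.n j hj, Finset.inter_comm]
      exact Finset.card_sdiff_add_card_inter _ _
    by_cases hjr : j = r
    · rw [if_pos hjr] at hA
      have hcn : c ∉ cls C C₁ α₀ j \ S' := by simp [hcS]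
      obtain ⟨U, hU1, hU2, hU3⟩ := Finset.exists_subsuperset_card_eq
        (s := {c}) (t := insert c (cls C C₁ α₀ j \ S')) (n := tyGet t j)
        (by simp) (by rw [Finset.card_singleton, hjr]; exact ht')
        (by rw [Finset.card_insert_of_notMem hcn]; omega)
      refine ⟨U, fun _ => ⟨?_, hU3, fun _ => hU1 (by simp), ?_⟩⟩
      · intro x hx
        have := hU2 hx
        simp only [Finset.mem_insert, Finset.mem_sdiff] at this
        rcases this with rfl | h
        · rw [hjr]; exact hcr
        · exact h.1
      · intro x hx hxS
        have := hU2 hx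
        simp only [Finset.mem_insert, Finset.mem_sdiff] at this
        tauto
    · rw [if_neg hjr] at hA
      obtain ⟨U, hU1, hU2⟩ := Finset.exists_subset_card_eq
        (s := cls C C₁ α₀ j \ S') (n := tyGet t j) (by omega)
      refine ⟨U, fun _ => ⟨?_, hU2, fun h => absurd h hjr, ?_⟩⟩
      · intro x hx
        exact (Finset.mem_sdiff.1 (hU1 hx)).1
      · intro x hx hxS
        exact absurd hxS (Finset.mem_sdiff.1 (hU1 hx)).2
  choose U hU using hU
  have hmem : ∀ x, x ∈ U 0 ∪ U 1 ∪ U 2 ↔ ∃ j, j < 3 ∧ x ∈ U j := by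
    intro x
    simp only [Finset.mem_union]
    constructor
    · rintro ((h | h) | h)
      exacts [⟨0, by omega, h⟩, ⟨1, by omega, h⟩, ⟨2, by omega, h⟩]
    · rintro ⟨j, hj, h⟩
      interval_cases j <;> tauto
  have hty : HasTy C C₁ α₀ (U 0 ∪ U 1 ∪ U 2) c t := by
    refine ⟨?_, ?_, ?_, hcr⟩
    · intro x hx
      obtain ⟨j, hj, h⟩ := (hmem x).1 hx
      exact cls_sub C C₁ α₀ h1 h0 j ((hU j hj).1 h)
    · intro j hj
      rw [← (hU j hj).2.1]
      congr 1
      ext x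
      rw [Finset.mem_inter, hmem]
      constructor
      · rintro ⟨⟨i, hi, hx⟩, hxj⟩
        have := hdj i j hi hj x ((hU i hi).1 hx) hxj
        rwa [← this]
      · intro hx
        exact ⟨⟨j, hj, hx⟩, (hU j hj).1 hx⟩
    · exact (hmem c).2 ⟨r, ht, (hU r ht).2.2.1 rfl⟩
  obtain ⟨S, cc, hch, hSk, hck⟩ := hR _ _ hty
  have hint : ∀ x ∈ S k, x ∈ S' → x = c := by
    intro x hx hx'
    rw [hSk] at hx
    obtain ⟨j, hj, h⟩ := (hmem x).1 hx
    exact (hU j hj).2.2.2 x h hx'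
  have hcardS' : S'.card = d (k + 1) := by
    rw [cls_card C C₁ α₀ h1 h0 S' hS'.sub, hS'.n 0 (by omega), hS'.n 1 (by omega),
      hS'.n 2 (by omega), ← hu2]
    rfl
  refine ⟨Function.update S (k + 1) S', Function.update cc (k + 1) c', ?_, by simp, by simp⟩
  have eS : ∀ i, i ≠ k + 1 → Function.update S (k + 1) S' i = S i := fun i hi =>
    Function.update_of_ne hi _ _
  have ec : ∀ i, i ≠ k + 1 → Function.update cc (k + 1) c' i = cc i := fun i hi =>
    Function.update_of_ne hi _ _
  have eS' : Function.update S (k + 1) S' (k + 1) = S' := by simp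
  have ec' : Function.update cc (k + 1) c' (k + 1) = c' := by simp
  constructor
  · rw [ec 0 (by omega)]; exact hch.c0
  · rw [eS 1 (by omega)]; exact hch.s1
  · intro i hi
    by_cases h : i = k
    · subst h; rw [eS']; exact hS'.sub
    · rw [eS _ (by omega)]; exact hch.sub i (by omega)
  · intro i hi
    by_cases h : i = k
    · subst h; rw [eS']; exact hcardS'
    · rw [eS _ (by omega)]; exact hch.crd i (by omega)
  · intro i hi
    by_cases h : i = k
    · subst h; rw [eS', ec _ (by omega), hck]; exact hcS
    · rw [eS _ (by omega), ec _ (by omega)]; exact hch.mem1 i (by omega)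
  · intro i hi
    by_cases h : i = k
    · subst h; rw [eS', ec']; exact hS'.mem
    · rw [eS _ (by omega), ec _ (by omega)]; exact hch.mem2 i (by omega)
  · intro i hi
    by_cases h : i = k
    · subst h; rw [ec', ec _ (by omega), hck]; exact hcc
    · rw [ec _ (by omega), ec _ (by omega)]; exact hch.ne i (by omega)
  · intro i hi1 hi
    by_cases h : i = k
    · subst h; rw [eS', eS _ (by omega), ec _ (by omega), hck]; exact hint
    · rw [eS _ (by omega), eS _ (by omega), ec _ (by omega)]; exact hch.inter i hi1 (by omega)

theorem check_sound (d : ℕ → ℕ) (C C₁ : Finset ℕ) (α₀ : ℕ) (h1 : C₁ ⊆ C) (h0 : α₀ ∈ C₁)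
    (N1 N2 : ℕ) (hN1 : (cls C C₁ α₀ 1).card = N1)
    (hN2 : (cls C C₁ α₀ 2).card = N2)
    (hsum : ∀ i, 1 ≤ i → i < 7 → d i + d (i + 1) ≤ 8)
    (hmid : ∀ i, 2 ≤ i → i ≤ 6 → 3 ≤ d i ∧ d i ≤ 5) (h7 : 2 ≤ d 7 ∧ d 7 ≤ 5) :
    ∀ f k : ℕ, ∀ R : List CTy, 1 ≤ k → k + f + 1 = 7 →
      (∀ t ∈ R, t.2.2.2 < 3 ∧ 1 ≤ tyGet t t.2.2.2 ∧ RealTy d C C₁ α₀ k t) →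
      tyCheck N1 N2 f (d k) R = true →
      ∀ u ∈ tyTypes N1 N2 (d 7), RealTy d C C₁ α₀ 7 u := by
  intro f
  induction f with
  | zero =>
    intro k R hk hf hR hc u hu
    obtain rfl : k = 6 := by omega
    rw [tyCheck, List.all_eq_true] at hc
    have hm : d 7 ∈ [2, 3, 4, 5] := by
      obtain ⟨ha, hb⟩ := h7
      interval_cases d 7 <;> simp
    have := hc _ hm
    have hs : Nat.ble (d 6 + d 7) 8 = true := Nat.ble_eq_true_of_le (hsum 6 (by omega) (by omega))
    rw [hs] at this
    simp only [Bool.not_true, Bool.false_or, List.all_eq_true, List.any_eq_true] at this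
    obtain ⟨t, htR, htr⟩ := this u hu
    obtain ⟨a, b, c⟩ := hR t htR
    exact real_step d C C₁ α₀ h1 h0 6 (by omega) N1 N2 hN1 hN2 t u a b hu c htr
  | succ f ih =>
    intro k R hk hf hR hc
    rw [tyCheck, List.all_eq_true] at hc
    have hm : d (k + 1) ∈ [3, 4, 5] := by
      obtain ⟨ha, hb⟩ := hmid (k + 1) (by omega) (by omega)
      interval_cases d (k + 1) <;> simp
    have := hc _ hm
    have hs : Nat.ble (d k + d (k + 1)) 8 = true := Nat.ble_eq_true_of_le (hsum k (by omega) (by omega))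
    rw [hs] at this
    simp only [Bool.not_true, Bool.false_or] at this
    refine ih (k + 1) _ (by omega) (by omega) ?_ this
    intro u hu
    rw [tyNext, List.mem_filter, List.any_eq_true] at hu
    obtain ⟨hu, t, htR, htr⟩ := hu
    have hu' := (mem_tyTypes _ _ _ _).1 hu
    obtain ⟨a, b, c⟩ := hR t htR
    exact ⟨hu'.2.2.2.2.1, hu'.2.2.2.2.2,
      real_step d C C₁ α₀ h1 h0 k hk N1 N2 hN1 hN2 t u a b hu c htr⟩

theorem exists_chain (d : ℕ → ℕ) (C C₁ Cl : Finset ℕ) (α₀ αl : ℕ) (hC : C.card = 7)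
    (h1 : C₁ ⊆ C) (hl : Cl ⊆ C) (hc1 : C₁.card = d 1) (hcl : Cl.card = d 7)
    (h0 : α₀ ∈ C₁) (h0l : αl ∈ Cl)
    (hsum : ∀ i, 1 ≤ i → i < 7 → d i + d (i + 1) ≤ 8)
    (hmid : ∀ i, 2 ≤ i → i ≤ 6 → 3 ≤ d i ∧ d i ≤ 5) (h7 : 2 ≤ d 7 ∧ d 7 ≤ 5)
    (hd1 : 2 ≤ d 1 ∧ d 1 ≤ 5) :
    ∃ S c, CChain d C C₁ α₀ 7 S c ∧ S 7 = Cl ∧ c 7 = αl := by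
  have hN1 : (cls C C₁ α₀ 1).card = d 1 - 1 := by
    simp [cls, Finset.card_erase_of_mem h0, hc1]
  have hN2 : (cls C C₁ α₀ 2).card = 7 - d 1 := by
    simp [cls, Finset.card_sdiff_of_subset h1, hc1, hC]
  have hck : tyCheck (d 1 - 1) (7 - d 1) 5 (d 1) [((1, d 1 - 1, 0, 1) : CTy)] = true := by
    have := List.all_eq_true.1 tyCheck_ok (d 1) (by
      obtain ⟨ha, hb⟩ := hd1
      interval_cases d 1 <;> simp)
    exact this
  have key := check_sound d C C₁ α₀ h1 h0 _ _ hN1 hN2 hsum hmid h7 5 1 _ (by omega) (by omega)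
    (by
      intro t ht
      rw [List.mem_singleton] at ht
      subst ht
      refine ⟨by simp, by simp [tyGet_one]; omega, ?_⟩
      intro S' c' hT
      have e0 := hT.n 0 (by omega)
      have e1 := hT.n 1 (by omega)
      have e2 := hT.n 2 (by omega)
      have hcc := hT.memc
      simp only [tyGet_zero, tyGet_one, tyGet_two] at e0 e1 e2 hcc
      have hsub : S' ⊆ C₁ := by
        intro x hx
        by_contra hxn
        have : x ∈ S' ∩ cls C C₁ α₀ 2 := by simp [cls, hx, hT.sub hx, hxn]
        rw [Finset.card_eq_zero.1 e2] at this
        simp at this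
      have hSC : S' = C₁ := by
        apply Finset.eq_of_subset_of_card_le hsub
        rw [cls_card C C₁ α₀ h1 h0 S' hT.sub, e0, e1, e2, hc1]
        omega
      simp [cls] at hcc
      refine ⟨fun _ => C₁, fun i => if i = 0 then α₀ else c', ?_, hSC.symm, by simp⟩
      constructor
      · simp
      · rfl
      · intros; exact h1
      · intro i hi
        obtain rfl : i = 0 := by omega
        exact hc1
      · intro i hi
        obtain rfl : i = 0 := by omega
        simpa using h0
      · intro i hi
        simpa using hcc.2
      · intro i hi
        obtain rfl : i = 0 := by omega
        simpa using Ne.symm hcc.1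
      · intro i hi hi'
        omega) hck
  obtain ⟨r, hr, hrm⟩ : ∃ r, r < 3 ∧ αl ∈ cls C C₁ α₀ r := by
    rcases cls_cover C C₁ α₀ αl (hl h0l) with h | h | h
    exacts [⟨0, by omega, h⟩, ⟨1, by omega, h⟩, ⟨2, by omega, h⟩]
  have hTy : HasTy C C₁ α₀ Cl αl ((Cl ∩ cls C C₁ α₀ 0).card, (Cl ∩ cls C C₁ α₀ 1).card,
      (Cl ∩ cls C C₁ α₀ 2).card, r) := by
    refine ⟨hl, ?_, h0l, hrm⟩
    intro j hj
    interval_cases j <;> rfl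
  refine key _ ?_ Cl αl hTy
  rw [mem_tyTypes]
  refine ⟨?_, ?_, ?_, ?_, hr, ?_⟩
  · have := Finset.card_le_card (Finset.inter_subset_right : Cl ∩ cls C C₁ α₀ 0 ⊆ _)
    have h : (cls C C₁ α₀ 0).card = 1 := by simp [cls]
    simp only
    omega
  · rw [← hcl, ← cls_card C C₁ α₀ h1 h0 Cl hl]
  · rw [← hN1]; exact Finset.card_le_card Finset.inter_subset_right
  · rw [← hN2]; exact Finset.card_le_card Finset.inter_subset_right
  · rw [← hTy.n r hr]
    exact Finset.card_pos.2 ⟨αl, Finset.mem_inter.2 ⟨h0l, hrm⟩⟩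

/-- Chain for the original degrees: interior sets are shrunk. -/
theorem exists_chain' (d : ℕ → ℕ) (C C₁ Cl : Finset ℕ) (α₀ αl : ℕ) (hC : C.card = 7)
    (h1 : C₁ ⊆ C) (hl : Cl ⊆ C) (hc1 : C₁.card = d 1) (hcl : Cl.card = d 7)
    (h0 : α₀ ∈ C₁) (h0l : αl ∈ Cl)
    (hd : ∀ i, 1 ≤ i → i ≤ 7 → 2 ≤ d i)
    (hd5 : ∀ i, 1 ≤ i → i ≤ 7 → d i ≤ 5)
    (hsum : ∀ i, 1 ≤ i → i < 7 → d i + d (i + 1) ≤ 8) :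
    ∃ S c, CChain d C C₁ α₀ 7 S c ∧ S 7 = Cl ∧ c 7 = αl := by
  set e : ℕ → ℕ := fun i => if i = 1 ∨ i = 7 then d i else max 3 (d i) with he
  have hde : ∀ i, d i ≤ e i := by
    intro i; simp only [he]; split_ifs <;> omega
  obtain ⟨S, c, hch, hS7, hc7⟩ := exists_chain e C C₁ Cl α₀ αl hC h1 hl (by simp [he, hc1])
    (by simp [he, hcl]) h0 h0l
    (by
      intro i hi hi'
      have a := hsum i hi hi'
      have a1 := hd5 i hi (by omega)
      have a2 := hd5 (i + 1) (by omega) (by omega)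
      simp only [he]
      split_ifs <;> omega)
    (by
      intro i hi hi'
      have a1 := hd5 i (by omega) (by omega)
      simp only [he]
      split_ifs <;> omega)
    (by simpa [he] using ⟨hd 7 (by omega) (by omega), hd5 7 (by omega) (by omega)⟩)
    (by simpa [he] using ⟨hd 1 (by omega) (by omega), hd5 1 (by omega) (by omega)⟩)
  have hT : ∀ i, ∃ T : Finset ℕ, i < 7 → c i ∈ T ∧ c (i + 1) ∈ T ∧ T ⊆ S (i + 1) ∧
      T.card = d (i + 1) := by
    intro i
    by_cases hi : i < 7
    swap
    · exact ⟨∅, fun h => absurd h hi⟩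
    obtain ⟨U, hU1, hU2, hU3⟩ := Finset.exists_subsuperset_card_eq
      (s := {c i, c (i + 1)}) (t := S (i + 1)) (n := d (i + 1))
      (by
        intro x hx
        simp only [Finset.mem_insert, Finset.mem_singleton] at hx
        rcases hx with rfl | rfl
        · exact hch.mem1 i hi
        · exact hch.mem2 i hi)
      (by rw [Finset.card_pair (hch.ne i hi)]; exact hd _ (by omega) (by omega))
      (by rw [hch.crd i hi]; exact hde _)
    exact ⟨U, fun _ => ⟨hU1 (by simp), hU1 (by simp), hU2, hU3⟩⟩
  choose T hT using hT
  have hTS : ∀ i, i < 7 → d (i + 1) = e (i + 1) → T i = S (i + 1) := by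
    intro i hi h
    apply Finset.eq_of_subset_of_card_le (hT i hi).2.2.1
    rw [(hT i hi).2.2.2, hch.crd i hi, h]
  refine ⟨fun i => T (i - 1), c, ?_, ?_, hc7⟩
  · constructor
    · exact hch.c0
    · have := hTS 0 (by omega) (by simp [he])
      simpa [hch.s1] using this
    · intro i hi
      exact (hT i hi).2.2.1.trans (hch.sub i hi)
    · intro i hi
      exact (hT i hi).2.2.2
    · intro i hi
      exact (hT i hi).1
    · intro i hi
      exact (hT i hi).2.1
    · exact hch.ne
    · intro i hi hi' x hx hx'
      refine hch.inter i hi hi' x ?_ ((hT i hi').2.2.1 hx')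
      have := (hT (i - 1) (by omega)).2.2.1 hx
      rwa [Nat.sub_add_cancel hi] at this
  · have := hTS 6 (by omega) (by simp [he])
    simpa [hS7] using this

/-! ### The graph -/

theorem cat_adj_ss (d : ℕ → ℕ) (i j : Fin 9) :
    (Cat 7 d).Adj (Sum.inl i) (Sum.inl j) ↔ (j : ℕ) = i + 1 ∨ (i : ℕ) = j + 1 := by
  simp only [Cat, SimpleGraph.fromRel_adj, CatRel]
  constructor
  · exact fun h => h.2
  · intro h
    refine ⟨?_, h⟩
    intro h'
    obtain rfl := Sum.inl_injective h'
    omega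

theorem cat_adj_ls (d : ℕ → ℕ) (p : Σ i : Fin 7, Fin (d (i.val + 1) - 2)) (j : Fin 9) :
    (Cat 7 d).Adj (Sum.inr p) (Sum.inl j) ↔ (j : ℕ) = p.1 + 1 := by
  simp [Cat, SimpleGraph.fromRel_adj, CatRel]

theorem cat_adj_sl (d : ℕ → ℕ) (p : Σ i : Fin 7, Fin (d (i.val + 1) - 2)) (j : Fin 9) :
    (Cat 7 d).Adj (Sum.inl j) (Sum.inr p) ↔ (j : ℕ) = p.1 + 1 := by
  rw [SimpleGraph.adj_comm, cat_adj_ls]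

theorem cat_adj_ll (d : ℕ → ℕ) (p q : Σ i : Fin 7, Fin (d (i.val + 1) - 2)) :
    ¬ (Cat 7 d).Adj (Sum.inr p) (Sum.inr q) := by
  simp [Cat, SimpleGraph.fromRel_adj, CatRel]

theorem cat_ndeg (d : ℕ → ℕ) (m : Fin 7) (hd : 2 ≤ d (m.val + 1)) :
    d (m.val + 1) ≤ ndeg (Cat 7 d) (Sum.inl ⟨m.val + 1, by omega⟩) := by
  let g : Fin (d (m.val + 1) - 2) ⊕ Fin 2 → CatV 7 d := fun x =>
    match x with
    | Sum.inl j => Sum.inr ⟨m, j⟩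
    | Sum.inr b => Sum.inl ⟨m.val + 2 * b.val, by omega⟩
  have hg : Function.Injective g := by
    rintro (a | a) (b | b) h
    · simpa [g] using h
    · simp [g] at h
    · simp [g] at h
    · simp only [g, Sum.inl.injEq, Fin.mk.injEq] at h
      congr 1
      ext
      omega
  have hsub : Set.range g ⊆ (Cat 7 d).neighborSet (Sum.inl ⟨m.val + 1, by omega⟩) := by
    rintro _ ⟨a | a, rfl⟩
    · rw [SimpleGraph.mem_neighborSet, cat_adj_sl]
    · rw [SimpleGraph.mem_neighborSet, cat_adj_ss]
      have := a.isLt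
      simp only
      omega
  have h1 := Set.ncard_le_ncard hsub (Set.toFinite _)
  have h2 : (Set.range g).ncard = d (m.val + 1) - 2 + 2 := by
    rw [← Set.image_univ, Set.ncard_image_of_injective _ hg, Set.ncard_univ]
    simp
  unfold ndeg
  omega

theorem ndeg_le_maxDeg (d : ℕ → ℕ) (v : CatV 7 d) :
    ndeg (Cat 7 d) v ≤ maxDeg (Cat 7 d) :=
  le_csSup (Set.finite_range _).bddAbove ⟨v, rfl⟩

theorem le_sigmaG (d : ℕ → ℕ) (u v : CatV 7 d) (h : (Cat 7 d).Adj u v) :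
    ndeg (Cat 7 d) u + ndeg (Cat 7 d) v - 1 ≤ sigmaG (Cat 7 d) := by
  refine le_csSup ?_ (show _ ∈ {m | ∃ x y, (Cat 7 d).Adj x y ∧
    m = ndeg (Cat 7 d) x + ndeg (Cat 7 d) y - 1} from ⟨u, v, h, rfl⟩)
  apply Set.Finite.bddAbove
  apply (Set.finite_range
    (fun p : CatV 7 d × CatV 7 d => ndeg (Cat 7 d) p.1 + ndeg (Cat 7 d) p.2 - 1)).subset
  rintro m ⟨x, y, _, rfl⟩
  exact ⟨(x, y), rfl⟩

abbrev spineE (d : ℕ → ℕ) (i : Fin 8) : Sym2 (CatV 7 d) :=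
  s(Sum.inl ⟨i.val, by omega⟩, Sum.inl ⟨i.val + 1, by omega⟩)

abbrev leafE (d : ℕ → ℕ) (p : Σ i : Fin 7, Fin (d (i.val + 1) - 2)) : Sym2 (CatV 7 d) :=
  s(Sum.inr p, Sum.inl ⟨p.1.val + 1, by omega⟩)

theorem spineE_mem (d : ℕ → ℕ) (i : Fin 8) : spineE d i ∈ (Cat 7 d).edgeSet := by
  rw [SimpleGraph.mem_edgeSet, cat_adj_ss]
  simp

theorem leafE_mem (d : ℕ → ℕ) (p : Σ i : Fin 7, Fin (d (i.val + 1) - 2)) :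
    leafE d p ∈ (Cat 7 d).edgeSet := by
  rw [SimpleGraph.mem_edgeSet, cat_adj_ls]

theorem edge_cases (d : ℕ → ℕ) (e : Sym2 (CatV 7 d)) (he : e ∈ (Cat 7 d).edgeSet) :
    (∃ i, e = spineE d i) ∨ ∃ p, e = leafE d p := by
  induction e using Sym2.ind with
  | _ u v =>
    rw [SimpleGraph.mem_edgeSet] at he
    rcases u with i | p <;> rcases v with j | q
    · rw [cat_adj_ss] at he
      left
      rcases he with he | he
      · refine ⟨⟨i.val, by omega⟩, ?_⟩
        have : j = ⟨i.val + 1, by omega⟩ := Fin.ext he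
        exact congrArg (fun k : Fin 9 => (s(Sum.inl i, Sum.inl k) : Sym2 (CatV 7 d))) this
      · refine ⟨⟨j.val, by omega⟩, ?_⟩
        have : i = ⟨j.val + 1, by omega⟩ := Fin.ext he
        rw [Sym2.eq_swap]
        exact congrArg (fun k : Fin 9 => (s(Sum.inl j, Sum.inl k) : Sym2 (CatV 7 d))) this
    · rw [cat_adj_sl] at he
      right
      refine ⟨q, ?_⟩
      have : i = ⟨q.1.val + 1, by omega⟩ := Fin.ext he
      rw [this, Sym2.eq_swap]
    · rw [cat_adj_ls] at he
      right
      refine ⟨p, ?_⟩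
      have : j = ⟨p.1.val + 1, by omega⟩ := Fin.ext he
      rw [this]
    · exact absurd he (cat_adj_ll d p q)

/-- Position of a vertex along the spine. -/
def vpos (d : ℕ → ℕ) : CatV 7 d → ℕ
  | Sum.inl i => i.val
  | Sum.inr p => p.1.val + 1

theorem vpos_adj (d : ℕ → ℕ) (u v : CatV 7 d) (h : u = v ∨ (Cat 7 d).Adj u v) :
    vpos d u ≤ vpos d v + 1 ∧ vpos d v ≤ vpos d u + 1 := by
  rcases h with rfl | h
  · omega
  · rcases u with i | p <;> rcases v with j | q
    · rw [cat_adj_ss] at h; simp only [vpos]; omega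
    · rw [cat_adj_sl] at h; simp only [vpos]; omega
    · rw [cat_adj_ls] at h; simp only [vpos]; omega
    · exact absurd h (cat_adj_ll d p q)

theorem vpos_spine (d : ℕ → ℕ) (i : Fin 8) (u : CatV 7 d) (h : u ∈ spineE d i) :
    vpos d u = i.val ∨ vpos d u = i.val + 1 := by
  rw [Sym2.mem_iff] at h
  rcases h with rfl | rfl <;> simp [vpos]

theorem vpos_leaf (d : ℕ → ℕ) (p : Σ i : Fin 7, Fin (d (i.val + 1) - 2)) (u : CatV 7 d)
    (h : u ∈ leafE d p) : vpos d u = p.1.val + 1 := by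
  rw [Sym2.mem_iff] at h
  rcases h with rfl | rfl <;> simp [vpos]

def colF (d : ℕ → ℕ) (c : ℕ → ℕ) (g : (Σ i : Fin 7, Fin (d (i.val + 1) - 2)) → ℕ) :
    CatV 7 d → CatV 7 d → ℕ
  | Sum.inl i, Sum.inl j => c (min i.val j.val)
  | Sum.inr p, Sum.inl _ => g p
  | Sum.inl _, Sum.inr p => g p
  | Sum.inr _, Sum.inr _ => 0

theorem colF_symm (d : ℕ → ℕ) (c : ℕ → ℕ) (g : (Σ i : Fin 7, Fin (d (i.val + 1) - 2)) → ℕ)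
    (u v : CatV 7 d) : colF d c g u v = colF d c g v u := by
  rcases u with i | p <;> rcases v with j | q <;> simp [colF, min_comm]

def colE (d : ℕ → ℕ) (c : ℕ → ℕ) (g : (Σ i : Fin 7, Fin (d (i.val + 1) - 2)) → ℕ) :
    Sym2 (CatV 7 d) → ℕ :=
  Sym2.lift ⟨colF d c g, colF_symm d c g⟩

theorem colE_spine (d : ℕ → ℕ) (c : ℕ → ℕ) (g : (Σ i : Fin 7, Fin (d (i.val + 1) - 2)) → ℕ)
    (i : Fin 8) : colE d c g (spineE d i) = c i.val := by
  simp [colE, colF]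

theorem colE_leaf (d : ℕ → ℕ) (c : ℕ → ℕ) (g : (Σ i : Fin 7, Fin (d (i.val + 1) - 2)) → ℕ)
    (p) : colE d c g (leafE d p) = g p := by
  simp [colE, colF]

theorem chain_leaves (d : ℕ → ℕ) (C C₁ : Finset ℕ) (α₀ : ℕ) (S : ℕ → Finset ℕ) (c : ℕ → ℕ)
    (h : CChain d C C₁ α₀ 7 S c) :
    ∃ g : (Σ i : Fin 7, Fin (d (i.val + 1) - 2)) → ℕ,
      (∀ p, g p ∈ S (p.1.val + 1) ∧ g p ≠ c p.1.val ∧ g p ≠ c (p.1.val + 1)) ∧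
      (∀ i a b, g ⟨i, a⟩ = g ⟨i, b⟩ → a = b) ∧
      (∀ i : Fin 7, ∀ x ∈ S (i.val + 1), x ≠ c i.val → x ≠ c (i.val + 1) →
        ∃ a, g ⟨i, a⟩ = x) := by
  have hcard : ∀ i : Fin 7, (((S (i.val + 1)).erase (c i.val)).erase (c (i.val + 1))).card
      = d (i.val + 1) - 2 := by
    intro i
    rw [Finset.card_erase_of_mem, Finset.card_erase_of_mem, h.crd _ i.isLt]
    · omega
    · exact h.mem1 _ i.isLt
    · exact Finset.mem_erase.2 ⟨(h.ne _ i.isLt).symm, h.mem2 _ i.isLt⟩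
  refine ⟨fun p => Finset.orderEmbOfFin _ (hcard p.1) p.2, ?_, ?_, ?_⟩
  · intro p
    have := Finset.orderEmbOfFin_mem _ (hcard p.1) p.2
    rw [Finset.mem_erase, Finset.mem_erase] at this
    exact ⟨this.2.2, this.2.1, this.1⟩
  · intro i a b hab
    exact (Finset.orderEmbOfFin _ (hcard i)).injective hab
  · intro i x hx h1 h2
    have : x ∈ Set.range (Finset.orderEmbOfFin _ (hcard i)) := by
      rw [Finset.range_orderEmbOfFin]
      simp [hx, h1, h2]
    exact this

theorem chain_to_coloring (d : ℕ → ℕ) (C C₁ Cl : Finset ℕ) (α₀ αl : ℕ) (S : ℕ → Finset ℕ)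
    (c : ℕ → ℕ) (h : CChain d C C₁ α₀ 7 S c) (hS7 : S 7 = Cl) (hc7 : c 7 = αl) :
    CatPrecolorExists 7 d C C₁ Cl α₀ αl := by
  obtain ⟨g, hg, hginj, hgsurj⟩ := chain_leaves d C C₁ α₀ S c h
  have F1 : ∀ i j, i < j → j ≤ i + 2 → j ≤ 7 → c i ≠ c j := by
    intro i j hij hj hj7 he
    obtain rfl | rfl : j = i + 1 ∨ j = i + 2 := by omega
    · exact h.ne i (by omega) he
    · have a := h.mem1 i (by omega)
      have b := h.mem2 (i + 1) (by omega)
      rw [← he] at b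
      exact h.ne i (by omega) (h.inter (i + 1) (by omega) (by omega) _ a b)
  have F2 : ∀ p, ∀ i, i ≤ 7 → i ≤ p.1.val + 2 → p.1.val ≤ i + 1 → g p ≠ c i := by
    intro p i hi h1 h2 he
    obtain ⟨a, b, b'⟩ := hg p
    have hp := p.1.isLt
    obtain h3 | h3 | h3 | h3 : i = p.1.val + 2 ∨ i = p.1.val + 1 ∨ i = p.1.val ∨
      p.1.val = i + 1 := by omega
    · rw [h3] at he
      have e := h.mem2 (p.1.val + 1) (by omega)
      rw [← he] at e
      exact b' (h.inter (p.1.val + 1) (by omega) (by omega) _ a e)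
    · rw [h3] at he; exact b' he
    · rw [h3] at he; exact b he
    · have e := h.mem1 i (by omega)
      rw [← he, ← h3] at e
      exact b (h.inter p.1.val (by omega) (by omega) _ e a)
  have F3' : ∀ p q : Σ i : Fin 7, Fin (d (i.val + 1) - 2), q.1.val = p.1.val + 1 →
      g p ≠ g q := by
    intro p q h1 he
    have a := (hg p).1
    have b := (hg q).1
    have hq := q.1.isLt
    rw [← he, h1] at b
    exact (hg p).2.2 (h.inter (p.1.val + 1) (by omega) (by omega) _ a b)
  have F3 : ∀ p q : Σ i : Fin 7, Fin (d (i.val + 1) - 2), p ≠ q → q.1.val ≤ p.1.val + 1 →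
      p.1.val ≤ q.1.val + 1 → g p ≠ g q := by
    intro p q hpq h1 h2
    obtain h3 | h3 | h3 : q.1.val = p.1.val + 1 ∨ p.1.val = q.1.val + 1 ∨
      p.1.val = q.1.val := by omega
    · exact F3' p q h3
    · exact (F3' q p h3).symm
    · obtain ⟨i, a⟩ := p
      obtain ⟨j, b⟩ := q
      obtain rfl : i = j := Fin.ext h3
      intro he
      exact hpq (by rw [hginj i a b he])
  have himg : ∀ m : Fin 7, colE d c g '' Einc (Cat 7 d) (Sum.inl ⟨m.val + 1, by omega⟩)
      = ↑(S (m.val + 1)) := by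
    intro m
    ext x
    constructor
    · rintro ⟨e, ⟨he, hv⟩, rfl⟩
      rcases edge_cases d e he with ⟨i, rfl⟩ | ⟨p, rfl⟩
      · rw [colE_spine]
        have := vpos_spine d i _ hv
        simp only [vpos] at this
        rcases this with h1 | h1
        · rw [← h1]; exact h.mem2 _ m.isLt
        · have : i.val = m.val := by omega
          rw [this]; exact h.mem1 _ m.isLt
      · rw [colE_leaf]
        have := vpos_leaf d p _ hv
        simp only [vpos] at this
        rw [this]
        exact (hg p).1
    · intro hx
      by_cases h1 : x = c m.val
      · refine ⟨spineE d ⟨m.val, by omega⟩, ⟨spineE_mem d _, by simp⟩, ?_⟩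
        rw [colE_spine, h1]
      · by_cases h2 : x = c (m.val + 1)
        · refine ⟨spineE d ⟨m.val + 1, by omega⟩, ⟨spineE_mem d _, by simp⟩, ?_⟩
          rw [colE_spine, h2]
        · obtain ⟨a, ha⟩ := hgsurj m x hx h1 h2
          refine ⟨leafE d ⟨m, a⟩, ⟨leafE_mem d _, by simp⟩, ?_⟩
          rw [colE_leaf, ha]
  refine ⟨colE d c g, ?_, ?_, ?_, ?_, ?_, ?_⟩
  · intro e he
    rcases edge_cases d e he with ⟨i, rfl⟩ | ⟨p, rfl⟩
    · rw [colE_spine]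
      by_cases hi : i.val < 7
      · exact h.sub _ hi (h.mem1 _ hi)
      · have : i.val = 6 + 1 := by omega
        rw [this]
        exact h.sub 6 (by omega) (h.mem2 6 (by omega))
    · rw [colE_leaf]
      exact h.sub _ p.1.isLt (hg p).1
  · intro e he f hf hef ⟨u, v, hu, hv, huv⟩
    have hpos := vpos_adj d u v huv
    rcases edge_cases d e he with ⟨i, rfl⟩ | ⟨p, rfl⟩ <;>
      rcases edge_cases d f hf with ⟨j, rfl⟩ | ⟨q, rfl⟩
    · have a := vpos_spine d i u hu
      have b := vpos_spine d j v hv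
      rw [colE_spine, colE_spine]
      have hij : i.val ≠ j.val := by
        intro hh
        exact hef (by rw [Fin.ext hh])
      rcases Nat.lt_or_gt_of_ne hij with hlt | hlt
      · exact F1 _ _ hlt (by omega) (by omega)
      · exact (F1 _ _ hlt (by omega) (by omega)).symm
    · have a := vpos_spine d i u hu
      have b := vpos_leaf d q v hv
      rw [colE_spine, colE_leaf]
      exact (F2 q i.val (by omega) (by omega) (by omega)).symm
    · have a := vpos_leaf d p u hu
      have b := vpos_spine d j v hv
      rw [colE_spine, colE_leaf]
      exact F2 p j.val (by omega) (by omega) (by omega)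
    · have a := vpos_leaf d p u hu
      have b := vpos_leaf d q v hv
      rw [colE_leaf, colE_leaf]
      refine F3 p q ?_ (by omega) (by omega)
      rintro rfl
      exact hef rfl
  · rw [← h.s1]
    exact himg 0
  · rw [← hS7]
    exact himg 6
  · rw [← h.c0]
    exact colE_spine d c g 0
  · rw [← hc7]
    exact colE_spine d c g 7

theorem twoSided_length7_sigma7 (d : ℕ → ℕ)
    (hd : ∀ i, 1 ≤ i → i ≤ 7 → 2 ≤ d i)
    (hσ : sigmaG (Cat 7 d) = 7)
    (hΔ : maxDeg (Cat 7 d) + 2 ≤ 7) :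
    TwoSidedPrecolorable 7 d 7 := by
  intro C C₁ Cl hC h1 hl hc1 hcl α₀ h0 αl h0l
  have hdeg : ∀ m : Fin 7, d (m.val + 1) ≤ ndeg (Cat 7 d) (Sum.inl ⟨m.val + 1, by omega⟩) :=
    fun m => cat_ndeg d m (hd _ (by omega) (by omega))
  have hd5 : ∀ i, 1 ≤ i → i ≤ 7 → d i ≤ 5 := by
    intro i hi hi'
    obtain ⟨m, rfl⟩ : ∃ m, i = m + 1 := ⟨i - 1, by omega⟩
    have a := hdeg ⟨m, by omega⟩
    have b := ndeg_le_maxDeg d (Sum.inl ⟨m + 1, by omega⟩)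
    simp only at a
    omega
  have hsum : ∀ i, 1 ≤ i → i < 7 → d i + d (i + 1) ≤ 8 := by
    intro i hi hi'
    obtain ⟨m, rfl⟩ : ∃ m, i = m + 1 := ⟨i - 1, by omega⟩
    have a := hdeg ⟨m, by omega⟩
    have b := hdeg ⟨m + 1, by omega⟩
    have e := le_sigmaG d (Sum.inl ⟨m + 1, by omega⟩) (Sum.inl ⟨m + 1 + 1, by omega⟩)
      ((cat_adj_ss d _ _).2 (Or.inl rfl))
    simp only at a b
    omega
  obtain ⟨S, c, hch, hS7, hc7⟩ :=
    exists_chain' d C C₁ Cl α₀ αl hC h1 hl hc1 hcl h0 h0l hd hd5 hsum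
  exact chain_to_coloring d C C₁ Cl α₀ αl S c hch hS7 hc7
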